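/- arXiv:1609.01950 — 2 statements merged into one kernel-verified Lean document; each statement's English description precedes it below -/
import Mathlib

section
/- Let m ≥ 1, r ≥ 1 and s ≥ 0 be integers and put s' = min(ord_p(m), s). Let a = (a_{s-1},…,a_0) ∈ W_s(L) satisfy p^i·ord_L(a_i) ≥ −m for all 0 ≤ i ≤ s−1 and p^i·ord_L(a_i) ≥ −(m−1) for all i ≥ s'. Let b_{s-1},…,b_0 ∈ L satisfy ord_L(b_i) ≥ r−1 for all i, and ord_L(b_i) ≥ r for every i with p^i·ord_L(a_i) = −m. Let ã ∈ W_s(L) be the Witt vector with components ã_i = a_i(1+b_i), and let c = (c_{s-1},…,c_0) = ã − a (difference in the Witt ring). Then: (i) if m = 1 and r = 1, then p^i·ord_L(c_i) ≥ 0 for all i; (ii) if r > 1, then p^i·ord_L(c_i) > −m + r for all 0 < i ≤ s−1, and ord_L(c_0) ≥ −m + r. -/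
/-!
Setting: `L` is a field of characteristic `p > 0` equipped with a normalized discrete
(additive) valuation `v = ord_L : L → ℤ ∪ {∞}` (normalization is expressed by the
existence of a uniformizer `π` with `v π = 1`).  `W_s(L)` is the ring of `p`-typical
Witt vectors of length `s` over `L`, written `a = (a_{s-1}, …, a_0)` with `a_{s-1}` the
leading component; the paper's component `a_i` is the component of standard index
`s - 1 - i`.  We realize `W_s(L)` as `TruncatedWittVector p s L`.
-/

noncomputable section

open TruncatedWittVector

variable (p : ℕ) [Fact p.Prime] (L : Type*) [Field L] [CharP L p]
variable (v : AddValuation L (WithTop ℤ))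

open MvPolynomial in
theorem isWeightedHomogeneous_wittPolynomial (q : ℕ) (R : Type*) [CommRing R] (n : ℕ) :
    IsWeightedHomogeneous (q ^ ·) (wittPolynomial q R n) (q ^ n) := by
  refine IsWeightedHomogeneous.sum _ _ _ fun i hi => isWeightedHomogeneous_monomial _ _ _ ?_
  rw [Finsupp.weight_single, smul_eq_mul, ← pow_add,
    Nat.sub_add_cancel (Nat.lt_succ_iff.mp (Finset.mem_range.mp hi))]

open MvPolynomial in
theorem isWeightedHomogeneous_rename {R M σ τ : Type*} [CommSemiring R] [AddCommMonoid M]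
    {w : τ → M} (f : σ → τ) {φ : MvPolynomial σ R} {n : M}
    (hφ : IsWeightedHomogeneous (w ∘ f) φ n) : IsWeightedHomogeneous w (rename f φ) n := by
  refine hφ.induction_on (motive := fun φ _ => IsWeightedHomogeneous w (rename f φ) n) ?_ ?_ ?_
  · simpa using isWeightedHomogeneous_zero R w n
  · intro φ ψ _ _ h₁ h₂
    simpa using h₁.add h₂
  · intro d r hd
    rw [rename_monomial]
    refine isWeightedHomogeneous_monomial _ _ _ ?_
    rw [← hd, Finsupp.weight_apply, Finsupp.weight_apply,
      Finsupp.sum_mapDomain_index (by simp) (by intros; rw [add_smul])]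
    rfl

open MvPolynomial in
theorem isWeightedHomogeneous_wittStructureRat_sub (n : ℕ) :
    IsWeightedHomogeneous (fun i : Fin 2 × ℕ => p ^ i.2)
      (wittStructureRat p (X 0 - X 1 : MvPolynomial (Fin 2) ℚ) n) (p ^ n) := by
  induction n using Nat.strong_induction_on with
  | _ n ih =>
    rw [wittStructureRat_rec]
    refine IsWeightedHomogeneous.C_mul (.sub ?_ ?_) _
    · rw [map_sub, bind₁_X_right, bind₁_X_right]
      exact .sub
        (isWeightedHomogeneous_rename _ (isWeightedHomogeneous_wittPolynomial p ℚ n))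
        (isWeightedHomogeneous_rename _ (isWeightedHomogeneous_wittPolynomial p ℚ n))
    · refine IsWeightedHomogeneous.sum _ _ _ fun i hi => .C_mul ?_ _
      have h := (ih i (Finset.mem_range.mp hi)).pow (p ^ (n - i))
      rwa [smul_eq_mul, ← pow_add, Nat.sub_add_cancel (Finset.mem_range.mp hi).le] at h

open MvPolynomial in
theorem isWeightedHomogeneous_wittSub (n : ℕ) :
    IsWeightedHomogeneous (fun i : Fin 2 × ℕ => p ^ i.2) (WittVector.wittSub p n) (p ^ n) := by
  intro d hd
  refine isWeightedHomogeneous_wittStructureRat_sub p n (d := d) ?_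
  have h := map_wittStructureInt p (X 0 - X 1 : MvPolynomial (Fin 2) ℤ) n
  rw [map_sub, map_X, map_X] at h
  rw [← h, coeff_map]
  exact (map_ne_zero_iff _ (RingHom.injective_int _)).mpr hd

/-- Both `x` and `y` have valuation at least `α`, and their difference gains `e` over `α`. -/
def AddValuationClose {K : Type*} [CommRing K] (u : AddValuation K (WithTop ℤ))
    (e α : WithTop ℤ) (x y : K) : Prop :=
  α ≤ u x ∧ α ≤ u y ∧ α + e ≤ u (x - y)

namespace AddValuationClose

variable {K : Type*} [CommRing K] {u : AddValuation K (WithTop ℤ)} {e α β : WithTop ℤ}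
  {x y x' y' : K}

theorem self (h : α ≤ u x) : AddValuationClose u e α x x :=
  ⟨h, h, by simp⟩

theorem add (h : AddValuationClose u e α x y) (h' : AddValuationClose u e α x' y') :
    AddValuationClose u e α (x + x') (y + y') :=
  ⟨u.map_le_add h.1 h'.1, u.map_le_add h.2.1 h'.2.1, by
    rw [add_sub_add_comm]
    exact u.map_le_add h.2.2 h'.2.2⟩

theorem mul (h : AddValuationClose u e α x y) (h' : AddValuationClose u e β x' y') :
    AddValuationClose u e (α + β) (x * x') (y * y') := by
  refine ⟨?_, ?_, ?_⟩
  · rw [u.map_mul]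
    exact add_le_add h.1 h'.1
  · rw [u.map_mul]
    exact add_le_add h.2.1 h'.2.1
  · rw [show x * x' - y * y' = (x - y) * x' + y * (x' - y') by ring]
    refine u.map_le_add ?_ ?_
    · rw [u.map_mul, add_right_comm]
      exact add_le_add h.2.2 h'.1
    · rw [u.map_mul, add_assoc]
      exact add_le_add h.2.1 h'.2.2

theorem one : AddValuationClose u e 0 1 1 :=
  self u.map_one.ge

theorem pow (h : AddValuationClose u e α x y) (n : ℕ) :
    AddValuationClose u e (n • α) (x ^ n) (y ^ n) := by
  induction n with
  | zero => simpa using one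
  | succ n ih =>
    rw [pow_succ, pow_succ, succ_nsmul]
    exact ih.mul h

theorem prod {ι : Type*} (t : Finset ι) {α : ι → WithTop ℤ} {x y : ι → K}
    (h : ∀ i ∈ t, AddValuationClose u e (α i) (x i) (y i)) :
    AddValuationClose u e (∑ i ∈ t, α i) (∏ i ∈ t, x i) (∏ i ∈ t, y i) := by
  induction t using Finset.cons_induction with
  | empty => simpa using one
  | cons i t hi ih =>
    rw [Finset.sum_cons, Finset.prod_cons, Finset.prod_cons]
    exact (h i (Finset.mem_cons_self i t)).mul
      (ih fun k hk => h k (Finset.mem_cons_of_mem hk))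

theorem _root_.AddValuation.intCast_nonneg (u : AddValuation K (WithTop ℤ)) (n : ℤ) :
    0 ≤ u (n : K) := by
  have hnat (k : ℕ) : 0 ≤ u (k : K) := by
    induction k with
    | zero => simp
    | succ k ih =>
      rw [Nat.cast_succ]
      exact u.map_le_add ih u.map_one.ge
  obtain ⟨k, rfl | rfl⟩ := n.eq_nat_or_neg
  · simpa using hnat k
  · simpa [u.map_neg] using hnat k

theorem aeval {σ : Type*} {w : σ → ℕ} {P : MvPolynomial σ ℤ} {n : ℕ}
    (hP : MvPolynomial.IsWeightedHomogeneous w P n) {γ : WithTop ℤ} {x y : σ → K}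
    (h : ∀ i, AddValuationClose u e (w i • γ) (x i) (y i)) :
    AddValuationClose u e (n • γ) (MvPolynomial.aeval x P) (MvPolynomial.aeval y P) := by
  refine hP.induction_on (motive := fun P _ => AddValuationClose u e (n • γ)
    (MvPolynomial.aeval x P) (MvPolynomial.aeval y P)) ?_ ?_ ?_
  · simpa using self (x := (0 : K)) (by simp)
  · intro P Q _ _ h₁ h₂
    simpa using h₁.add h₂
  · intro d c hd
    rw [MvPolynomial.aeval_monomial, MvPolynomial.aeval_monomial]
    have hc : AddValuationClose u e 0 (algebraMap ℤ K c) (algebraMap ℤ K c) :=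
      self (by simpa using u.intCast_nonneg c)
    have hprod := hc.mul (prod d.support fun i _ => (h i).pow (d i))
    have hdeg : (0 : WithTop ℤ) + ∑ i ∈ d.support, d i • w i • γ = n • γ := by
      rw [zero_add, ← hd, Finsupp.weight_apply, Finsupp.sum, Finset.sum_smul]
      simp_rw [smul_assoc]
    rwa [hdeg] at hprod

end AddValuationClose

theorem WittVector.le_addValuation_sub_coeff {K : Type*} [CommRing K]
    (u : AddValuation K (WithTop ℤ)) {e γ : WithTop ℤ} (x y : WittVector p K)
    (h : ∀ k, AddValuationClose u e (p ^ k • γ) (x.coeff k) (y.coeff k)) (n : ℕ) :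
    p ^ n • γ + e ≤ u ((x - y).coeff n) := by
  have key := (AddValuationClose.aeval (isWeightedHomogeneous_wittSub p n) (γ := γ)
    (x := Function.uncurry ![x.coeff, y.coeff]) (y := Function.uncurry ![y.coeff, y.coeff])
    (e := e) (u := u) (by
      rintro ⟨i, k⟩
      fin_cases i
      · exact h k
      · exact .self (h k).2.1)).2.2
  change _ ≤ u (WittVector.peval (WittVector.wittSub p n) ![x.coeff, y.coeff] -
    WittVector.peval (WittVector.wittSub p n) ![y.coeff, y.coeff]) at key
  rwa [← WittVector.sub_coeff, ← WittVector.sub_coeff, sub_self, WittVector.zero_coeff,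
    sub_zero] at key

/-- The additive valuation `N • u`. -/
def AddValuation.nsmul {K : Type*} [CommRing K] (u : AddValuation K (WithTop ℤ)) (N : ℕ)
    (hN : N ≠ 0) : AddValuation K (WithTop ℤ) :=
  u.map (nsmulAddMonoidHom N)
    (by cases N with
      | zero => exact absurd rfl hN
      | succ N => simp [succ_nsmul])
    (fun _ _ h => nsmul_le_nsmul_right h N)

theorem AddValuation.nsmul_apply {K : Type*} [CommRing K] (u : AddValuation K (WithTop ℤ))
    (N : ℕ) (hN : N ≠ 0) (x : K) : u.nsmul N hN x = N • u x :=
  rfl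

theorem WithTop.nsmul_neg_add_le_nsmul_add {P Q : ℕ} (hP : 0 < P) (hQ : 0 < Q) {m r : ℤ}
    {A B : WithTop ℤ} (hA : -(m : WithTop ℤ) ≤ Q • A) (hB : (r : WithTop ℤ) - 1 ≤ B)
    (hB' : Q • A = -(m : WithTop ℤ) → (r : WithTop ℤ) ≤ B) :
    P • (-(m : WithTop ℤ)) + ((P * Q * (r - 1) + 1 : ℤ) : WithTop ℤ) ≤ (P * Q) • (A + B) := by
  have hPQ : P * Q ≠ 0 := (Nat.mul_pos hP hQ).ne'
  have htop : (P * Q) • (⊤ : WithTop ℤ) = ⊤ := by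
    obtain ⟨k, hk⟩ := Nat.exists_eq_succ_of_ne_zero hPQ
    simp [hk, succ_nsmul]
  cases A with
  | top => rw [top_add, htop]; exact le_top
  | coe A =>
    cases B with
    | top => rw [add_top, htop]; exact le_top
    | coe B =>
      norm_cast at hA hB hB' ⊢
      simp only [nsmul_eq_mul] at hA hB' ⊢
      have hP' : (1 : ℤ) ≤ P := by exact_mod_cast hP
      have hPQ' : (1 : ℤ) ≤ P * Q := by exact_mod_cast Nat.mul_pos hP hQ
      push_cast at *
      rcases hA.eq_or_lt with h | h
      · have := hB' h.symm
        rw [mul_add, mul_assoc _ _ A, ← h]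
        nlinarith
      · have h₁ : (P : ℤ) * (-m + 1) ≤ P * (Q * A) := mul_le_mul_of_nonneg_left h (by omega)
        have h₂ : (P : ℤ) * Q * (r - 1) ≤ P * Q * B := mul_le_mul_of_nonneg_left hB (by omega)
        linarith

theorem WithTop.lt_nsmul_of_nsmul_add_le {P Q : ℕ} (hQ : 0 < Q) {m r : ℤ}
    {C : WithTop ℤ}
    (h : P • (-(m : WithTop ℤ)) + ((P * Q * (r - 1) + 1 : ℤ) : WithTop ℤ) ≤ (P * Q) • C) :
    ((-m + Q * (r - 1) : ℤ) : WithTop ℤ) < Q • C := by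
  cases C with
  | top =>
    obtain ⟨k, rfl⟩ := Nat.exists_eq_succ_of_ne_zero hQ.ne'
    rw [succ_nsmul, add_top]
    exact WithTop.coe_lt_top _
  | coe C =>
    norm_cast at h ⊢
    simp only [nsmul_eq_mul] at h ⊢
    push_cast at *
    refine lt_of_mul_lt_mul_left (a := (P : ℤ)) ?_ (Int.natCast_nonneg P)
    linarith

/-- The common refinement of both estimates: passing from `a` to `a (1 + b)` componentwise changes
the component of index `j` only by an element `c` with `p ^ (s - 1 - j) • v c` strictly larger than
`-m + p ^ (s - 1 - j) * (r - 1)`. -/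
theorem TruncatedWittVector.lt_nsmul_addValuation_sub_coeff {K : Type*} [CommRing K]
    (u : AddValuation K (WithTop ℤ)) {m r : ℤ} (hr : 1 ≤ r) {s : ℕ}
    (a : TruncatedWittVector p s K) (b : Fin s → K)
    (ha : ∀ j : Fin s, -(m : WithTop ℤ) ≤ p ^ (s - 1 - (j : ℕ)) • u (a.coeff j))
    (hb : ∀ j : Fin s, (r : WithTop ℤ) - 1 ≤ u (b j))
    (hb' : ∀ j : Fin s, p ^ (s - 1 - (j : ℕ)) • u (a.coeff j) = -(m : WithTop ℤ) →
      (r : WithTop ℤ) ≤ u (b j)) (j : Fin s) :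
    ((-m + (p ^ (s - 1 - (j : ℕ)) : ℕ) * (r - 1) : ℤ) : WithTop ℤ) < p ^ (s - 1 - (j : ℕ)) •
      u ((TruncatedWittVector.mk p (fun i => a.coeff i * (1 + b i)) - a).coeff j) := by
  have hp (k : ℕ) : 0 < p ^ k := pow_pos (Fact.out : p.Prime).pos k
  have hsplit (k : Fin s) : p ^ (s - 1) = p ^ (k : ℕ) * p ^ (s - 1 - (k : ℕ)) := by
    rw [← pow_add]
    congr 1
    omega
  refine WithTop.lt_nsmul_of_nsmul_add_le (P := p ^ (j : ℕ)) (hp _) ?_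
  have key := WittVector.le_addValuation_sub_coeff p (u.nsmul (p ^ (s - 1)) (hp _).ne')
    (e := ((p ^ (s - 1) : ℕ) * (r - 1) + 1 : ℤ)) (γ := -(m : WithTop ℤ))
    (TruncatedWittVector.mk p fun i => a.coeff i * (1 + b i)).out a.out (fun k => ?_) j
  · rw [AddValuation.nsmul_apply, hsplit j] at key
    rw [show (TruncatedWittVector.mk p (fun i => a.coeff i * (1 + b i)) - a).coeff j =
      ((TruncatedWittVector.mk p fun i => a.coeff i * (1 + b i)).out - a.out).coeff j from
      WittVector.coeff_truncateFun _ _]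
    exact_mod_cast key
  by_cases hk : k < s
  · lift k to Fin s using hk
    have hle : p ^ (k : ℕ) • (-(m : WithTop ℤ)) ≤
        u.nsmul (p ^ (s - 1)) (hp _).ne' (a.coeff k) := by
      rw [AddValuation.nsmul_apply, hsplit k, mul_comm, mul_nsmul]
      exact nsmul_le_nsmul_right (ha k) _
    have hb0 : 0 ≤ u (b k) := le_trans (by
      rw [← WithTop.coe_one, ← WithTop.LinearOrderedAddCommGroup.coe_sub]
      exact_mod_cast sub_nonneg.mpr hr) (hb k)
    rw [TruncatedWittVector.coeff_out, TruncatedWittVector.coeff_out,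
      TruncatedWittVector.coeff_mk]
    refine ⟨?_, hle, ?_⟩
    · rw [AddValuation.map_mul]
      refine hle.trans (le_add_of_nonneg_right ?_)
      rw [AddValuation.nsmul_apply]
      exact nsmul_nonneg (u.map_le_add u.map_one.ge hb0) _
    · rw [show a.coeff k * (1 + b k) - a.coeff k = a.coeff k * b k by ring,
        AddValuation.nsmul_apply, u.map_mul, hsplit k]
      exact_mod_cast WithTop.nsmul_neg_add_le_nsmul_add (hp k) (hp _) (ha k) (hb k) (hb' k)
  · have h0 (x : TruncatedWittVector p s K) : x.out.coeff k = 0 := dif_neg hk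
    rw [h0, h0]
    exact .self (by simp)

/-- Lemma 2.8 of the paper.  Let `m ≥ 1`, `r ≥ 1`, `s ≥ 0`,
`s' = min(ord_p m, s)`.  Let `a = (a_{s-1}, …, a_0) ∈ W_s(L)` with
`p^i · ord_L(a_i) ≥ -m` for all `i` and `p^i · ord_L(a_i) ≥ -(m-1)` for `i ≥ s'`
(i.e. `a ∈ fil'_m W_s(L)`, componentwise).  Let `b_{s-1}, …, b_0 ∈ L` with
`ord_L(b_i) ≥ r - 1` for all `i` and `ord_L(b_i) ≥ r` whenever `p^i · ord_L(a_i) = -m`.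
Let `ã` have components `ã_i = a_i (1 + b_i)` and `c = (c_{s-1}, …, c_0) = ã - a`
(difference in the Witt ring).  Then:
(i) if `m = 1` and `r = 1`, then `p^i · ord_L(c_i) ≥ 0` for all `i`;
(ii) if `r > 1`, then `p^i · ord_L(c_i) > -m + r` for all `0 < i ≤ s-1` and
`ord_L(c_0) ≥ -m + r`.
(Recall the paper's index `i` is the standard index `s - 1 - j`; so `i > 0` means
`j < s - 1` and `i = 0` means `j = s - 1`, and the weight `p^i` is `p ^ (s - 1 - j)`.) -/
theorem statement18 (hv : ∃ π : L, v π = 1) (m r s : ℕ) (hm : 1 ≤ m) (hr : 1 ≤ r)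
    (a : TruncatedWittVector p s L) (b : Fin s → L)
    (ha : ∀ j : Fin s,
        ((-(m : ℤ)) : WithTop ℤ) ≤ p ^ (s - 1 - (j : ℕ)) • v (a.coeff j))
    (ha' : ∀ j : Fin s, (j : ℕ) < s - min (padicValNat p m) s →
        ((-((m : ℤ) - 1)) : WithTop ℤ) ≤ p ^ (s - 1 - (j : ℕ)) • v (a.coeff j))
    (hb : ∀ j : Fin s, (((r : ℤ) - 1) : WithTop ℤ) ≤ v (b j))
    (hb' : ∀ j : Fin s,
        p ^ (s - 1 - (j : ℕ)) • v (a.coeff j) = ((-(m : ℤ)) : WithTop ℤ) →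
        ((r : ℤ) : WithTop ℤ) ≤ v (b j)) :
    (m = 1 → r = 1 → ∀ j : Fin s,
        (0 : WithTop ℤ) ≤ p ^ (s - 1 - (j : ℕ)) •
          v ((TruncatedWittVector.mk p (fun i => a.coeff i * (1 + b i)) - a).coeff j)) ∧
    (1 < r →
      (∀ j : Fin s, (j : ℕ) < s - 1 →
        ((-(m : ℤ) + (r : ℤ)) : WithTop ℤ) < p ^ (s - 1 - (j : ℕ)) •
          v ((TruncatedWittVector.mk p (fun i => a.coeff i * (1 + b i)) - a).coeff j)) ∧
      (∀ j : Fin s, (j : ℕ) = s - 1 →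
        ((-(m : ℤ) + (r : ℤ)) : WithTop ℤ) ≤
          v ((TruncatedWittVector.mk p (fun i => a.coeff i * (1 + b i)) - a).coeff j))) := by
  have key := TruncatedWittVector.lt_nsmul_addValuation_sub_coeff p v (m := m) (r := r)
    (by exact_mod_cast hr) a b ha hb hb'
  refine ⟨?_, fun hr₁ => ⟨fun j hj => ?_, fun j hj => ?_⟩⟩
  · rintro rfl rfl j
    have h := key j
    generalize p ^ (s - 1 - (j : ℕ)) • v _ = C at h ⊢
    cases C with
    | top => exact le_top
    | coe C =>
      rw [WithTop.coe_lt_coe] at h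
      rw [← WithTop.coe_zero, WithTop.coe_le_coe]
      push_cast at h
      linarith
  · refine lt_of_le_of_lt ?_ (key j)
    have hQ : 2 ≤ p ^ (s - 1 - (j : ℕ)) :=
      (Fact.out : p.Prime).two_le.trans (Nat.le_self_pow (by omega) p)
    generalize p ^ (s - 1 - (j : ℕ)) = Q at hQ
    rw [← WithTop.LinearOrderedAddCommGroup.coe_neg, ← WithTop.coe_add, WithTop.coe_le_coe]
    have hQ' : (2 : ℤ) ≤ Q := by exact_mod_cast hQ
    have hr' : (2 : ℤ) ≤ r := by exact_mod_cast hr₁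
    nlinarith
  · have h := key j
    rw [hj, Nat.sub_self, pow_zero, one_nsmul] at h
    generalize v _ = C at h ⊢
    cases C with
    | top => exact le_top
    | coe C =>
      rw [← WithTop.LinearOrderedAddCommGroup.coe_neg, ← WithTop.coe_add, WithTop.coe_le_coe]
      rw [WithTop.coe_lt_coe] at h
      omega
end
end

section
/- Let m ≥ 2 and s ≥ 0 be integers and put s' = min(ord_p(m), s). Let a = (a_{s-1},…,a_0) ∈ W_s(L) satisfy p^i·ord_L(a_i) ≥ −m for all 0 ≤ i ≤ s−1 and p^i·ord_L(a_i) ≥ −(m−1) for all i ≥ s'. Let b_{s-1},…,b_0 ∈ L satisfy ord_L(b_i) ≥ m−1 for all i, and ord_L(b_i) ≥ m for every i with p^i·ord_L(a_i) = −m. Let ã ∈ W_s(L) be the Witt vector with components ã_i = a_i(1+b_i), and let c = (c_{s-1},…,c_0) = ã − a (difference in the Witt ring). Then ord_L(c_0 − Σ_{i=0}^{s-1} a_i^{p^i} b_i) > 0. -/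
/-!
Setting: `L` is a field of characteristic `p > 0` equipped with a normalized discrete
(additive) valuation `v = ord_L : L → ℤ ∪ {∞}` (normalization is expressed by the
existence of a uniformizer `π` with `v π = 1`).  `W_s(L)` is the ring of `p`-typical
Witt vectors of length `s` over `L`, written `a = (a_{s-1}, …, a_0)` with `a_{s-1}` the
leading component; the paper's component `a_i` is the component of standard index
`s - 1 - i`.  We realize `W_s(L)` as `TruncatedWittVector p s L`.
-/

namespace WittDifference

open MvPolynomial

/-- Integral polynomials in the variables `A_j = X (inl j)` and `Z_j = X (inr j)` that are isobaric
of weight `w`, both `A_j` and `Z_j` having weight `p ^ j`, and all of whose monomials have total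
degree at least `k` in the variables `Z_j`. -/
noncomputable def isobaric (p k w : ℕ) : Submodule ℤ (MvPolynomial (ℕ ⊕ ℕ) ℤ) :=
  restrictSupport ℤ {d | Finsupp.weight (Sum.elim (p ^ ·) (p ^ ·) : ℕ ⊕ ℕ → ℕ) d = w ∧
    k ≤ Finsupp.weight (Sum.elim 0 1 : ℕ ⊕ ℕ → ℕ) d}

section Isobaric

variable {p k k' w w' : ℕ} {f g : MvPolynomial (ℕ ⊕ ℕ) ℤ}

lemma isobaric_anti (h : k' ≤ k) : isobaric p k w ≤ isobaric p k' w :=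
  restrictSupport_mono _ fun _ hd => ⟨hd.1, h.trans hd.2⟩

lemma mul_mem_isobaric (hf : f ∈ isobaric p k w) (hg : g ∈ isobaric p k' w') :
    f * g ∈ isobaric p (k + k') (w + w') := by
  have h := Submodule.mul_mem_mul hf hg
  rw [isobaric, isobaric, ← restrictSupport_add] at h
  refine restrictSupport_mono _ ?_ h
  rintro _ ⟨d, hd, e, he, rfl⟩
  simp only [Set.mem_ofPred_eq, map_add] at hd he ⊢
  omega

lemma one_mem_isobaric : (1 : MvPolynomial (ℕ ⊕ ℕ) ℤ) ∈ isobaric p 0 0 := by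
  rw [isobaric, ← C_1, C_apply, monomial_mem_restrictSupport]
  simp

lemma pow_mem_isobaric (hf : f ∈ isobaric p k w) (n : ℕ) :
    f ^ n ∈ isobaric p (n * k) (n * w) := by
  induction n with
  | zero => simpa using one_mem_isobaric
  | succ n ih => simpa only [pow_succ, Nat.succ_mul] using mul_mem_isobaric ih hf

lemma natCast_mul_mem_isobaric (n : ℕ) (hf : f ∈ isobaric p k w) :
    (n : MvPolynomial (ℕ ⊕ ℕ) ℤ) * f ∈ isobaric p k w := by
  rw [← nsmul_eq_mul]
  exact nsmul_mem hf n

lemma mem_isobaric_of_natCast_mul_mem {n : ℕ} (hn : n ≠ 0)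
    (hf : (n : MvPolynomial (ℕ ⊕ ℕ) ℤ) * f ∈ isobaric p k w) : f ∈ isobaric p k w := by
  rw [isobaric, mem_restrictSupport_iff] at hf ⊢
  refine fun d hd => hf ?_
  rw [Finset.mem_coe, mem_support_iff] at hd ⊢
  rw [← nsmul_eq_mul, coeff_smul]
  simpa [hn] using hd

lemma X_inl_mem_isobaric (j : ℕ) : X (.inl j) ∈ isobaric p 0 (p ^ j) := by
  rw [isobaric, X, monomial_mem_restrictSupport]
  simp [Finsupp.weight_single]

lemma X_inr_mem_isobaric (j : ℕ) : X (.inr j) ∈ isobaric p 1 (p ^ j) := by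
  rw [isobaric, X, monomial_mem_restrictSupport]
  simp [Finsupp.weight_single]

lemma add_pow_succ_sub_mem_isobaric (hf : f ∈ isobaric p 0 w) (hg : g ∈ isobaric p 1 w) (n : ℕ) :
    (f + g) ^ (n + 1) - f ^ (n + 1) - ((n + 1 : ℕ) : MvPolynomial (ℕ ⊕ ℕ) ℤ) * (f ^ n * g) ∈
      isobaric p 2 ((n + 1) * w) := by
  induction n with
  | zero => simp
  | succ n ih =>
    have h₁ := mul_mem_isobaric (add_mem hf (isobaric_anti zero_le_one hg)) ih
    have h₂ := natCast_mul_mem_isobaric (n + 1)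
      (mul_mem_isobaric (pow_mem_isobaric hf n) (mul_mem_isobaric hg hg))
    have e₁ : w + (n + 1) * w = (n + 1 + 1) * w := by ring
    have e₂ : n * w + (w + w) = (n + 1 + 1) * w := by ring
    rw [e₁, zero_add] at h₁
    rw [e₂, mul_zero, zero_add] at h₂
    convert add_mem h₁ h₂ using 1
    push_cast
    ring

lemma pow_mul_pow_sub {n j : ℕ} (h : j ≤ n) : p ^ (n - j) * p ^ j = p ^ n := by
  rw [← pow_add, Nat.sub_add_cancel h]

end Isobaric

variable {p : ℕ} [Fact p.Prime]

lemma sum_coeff_sub {R : Type*} [CommRing R] (x y : WittVector p R) (n : ℕ) :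
    ∑ i ∈ Finset.range (n + 1), (p : R) ^ i * (x - y).coeff i ^ p ^ (n - i) =
      ∑ i ∈ Finset.range (n + 1), (p : R) ^ i * (x.coeff i ^ p ^ (n - i) -
        y.coeff i ^ p ^ (n - i)) := by
  have h := map_sub (WittVector.ghostComponent (p := p) (R := R) n) x y
  simpa only [WittVector.ghostComponent_apply, aeval_wittPolynomial, mul_sub, Finset.sum_sub_distrib] using h

variable (p) in
/-- The components of the Witt vector `(A_j + Z_j)_j - (A_j)_j`. -/
noncomputable def diffPoly (n : ℕ) : MvPolynomial (ℕ ⊕ ℕ) ℤ :=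
  (WittVector.mk p (fun j => X (.inl j) + X (.inr j)) -
    WittVector.mk p (fun j => X (.inl j)) : WittVector p (MvPolynomial (ℕ ⊕ ℕ) ℤ)).coeff n

variable (p) in
/-- The part of `diffPoly p n` that is linear in the variables `Z_j`. -/
noncomputable def diffLinear (n : ℕ) : MvPolynomial (ℕ ⊕ ℕ) ℤ :=
  ∑ j ∈ Finset.range (n + 1), X (.inl j) ^ (p ^ (n - j) - 1) * X (.inr j)

lemma aeval_diffPoly {R : Type*} [CommRing R] (x z : ℕ → R) (n : ℕ) :
    aeval (Sum.elim x z) (diffPoly p n) =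
      (WittVector.mk p (fun j => x j + z j) - WittVector.mk p x).coeff n := by
  let φ : MvPolynomial (ℕ ⊕ ℕ) ℤ →+* R := (aeval (Sum.elim x z)).toRingHom
  have h : φ (diffPoly p n) = _ := (WittVector.map_coeff φ _ n).symm
  rw [map_sub] at h
  refine h.trans ?_
  congr 2 <;> ext j <;> simp [φ, WittVector.map_coeff]

lemma diffLinear_mem_isobaric (n : ℕ) : diffLinear p n ∈ isobaric p 1 (p ^ n) := by
  refine sum_mem fun j hj => ?_
  have h := mul_mem_isobaric (pow_mem_isobaric (X_inl_mem_isobaric (p := p) j) (p ^ (n - j) - 1))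
    (X_inr_mem_isobaric j)
  have h1 : 1 ≤ p ^ (n - j) := Nat.one_le_pow _ _ (Fact.out : p.Prime).pos
  rwa [mul_zero, zero_add, ← Nat.succ_mul, Nat.succ_eq_add_one, Nat.sub_add_cancel h1,
    pow_mul_pow_sub (Finset.mem_range_succ_iff.mp hj)] at h

theorem diffPoly_sub_diffLinear_mem_isobaric (n : ℕ) :
    diffPoly p n - diffLinear p n ∈ isobaric p 2 (p ^ n) := by
  have hp : p.Prime := Fact.out
  induction n using Nat.strong_induction_on with
  | _ n ih =>
  have key := sum_coeff_sub (p := p) (WittVector.mk p (fun j => X (.inl j) + X (.inr j)))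
    (WittVector.mk p (fun j => X (.inl j)) : WittVector p (MvPolynomial (ℕ ⊕ ℕ) ℤ)) n
  simp only [WittVector.coeff_mk] at key
  change ∑ i ∈ Finset.range (n + 1), (p : MvPolynomial (ℕ ⊕ ℕ) ℤ) ^ i *
    diffPoly p i ^ p ^ (n - i) = _ at key
  rw [Finset.sum_range_succ, Nat.sub_self, pow_zero, pow_one] at key
  apply mem_isobaric_of_natCast_mul_mem (pow_ne_zero n hp.ne_zero)
  have hlow : ∑ i ∈ Finset.range n, (p : MvPolynomial (ℕ ⊕ ℕ) ℤ) ^ i *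
      diffPoly p i ^ p ^ (n - i) ∈ isobaric p 2 (p ^ n) := by
    refine sum_mem fun i hi => ?_
    rw [Finset.mem_range] at hi
    have hi' : diffPoly p i ∈ isobaric p 1 (p ^ i) := by
      simpa using add_mem (isobaric_anti one_le_two (ih i hi)) (diffLinear_mem_isobaric i)
    have h := pow_mem_isobaric hi' (p ^ (n - i))
    rw [pow_mul_pow_sub hi.le, mul_one] at h
    rw [← Nat.cast_pow]
    refine natCast_mul_mem_isobaric _ (isobaric_anti ?_ h)
    exact hp.two_le.trans (Nat.le_self_pow (by omega) p)
  have htop : ∑ j ∈ Finset.range (n + 1), (p : MvPolynomial (ℕ ⊕ ℕ) ℤ) ^ j *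
      ((X (.inl j) + X (.inr j)) ^ p ^ (n - j) - X (.inl j) ^ p ^ (n - j)) -
      (p : MvPolynomial (ℕ ⊕ ℕ) ℤ) ^ n * diffLinear p n ∈ isobaric p 2 (p ^ n) := by
    rw [diffLinear, Finset.mul_sum, ← Finset.sum_sub_distrib]
    refine sum_mem fun j hj => ?_
    have hj' := Finset.mem_range_succ_iff.mp hj
    obtain ⟨q, hq⟩ : ∃ q, p ^ (n - j) = q + 1 :=
      Nat.exists_eq_succ_of_ne_zero (pow_ne_zero _ hp.ne_zero)
    have h := natCast_mul_mem_isobaric (p ^ j)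
      (add_pow_succ_sub_mem_isobaric (X_inl_mem_isobaric (p := p) j) (X_inr_mem_isobaric j) q)
    rw [← hq, pow_mul_pow_sub hj'] at h
    convert h using 1
    rw [← Nat.cast_pow p n, ← pow_mul_pow_sub (p := p) hj', hq, Nat.add_sub_cancel]
    push_cast
    ring
  convert sub_mem htop hlow using 1
  rw [← key]
  push_cast
  ring

section Valuation

variable {L : Type*} [CommRing L] (v : AddValuation L (WithTop ℤ))

lemma le_map_intCast (z : ℤ) : 0 ≤ v (z : L) := by
  have hn (n : ℕ) : 0 ≤ v (n : L) := by
    induction n with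
    | zero => simp
    | succ n ih =>
      rw [Nat.cast_succ]
      exact v.map_le_add ih v.map_one.ge
  obtain ⟨n, rfl | rfl⟩ := z.eq_nat_or_neg
  · simpa using hn n
  · simpa [AddValuation.map_neg] using hn n

lemma le_map_finsuppProd {ι : Type*} {g : ι → L} {γ : ι → ℤ} (hg : ∀ i, (γ i : WithTop ℤ) ≤ v (g i))
    (d : ι →₀ ℕ) : ((Finsupp.weight γ d : ℤ) : WithTop ℤ) ≤ v (d.prod fun i e => g i ^ e) := by
  induction d using Finsupp.induction_linear with
  | zero => simp
  | add d e hd he =>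
    classical
    rw [Finsupp.prod_add_index' (by simp) (by simp [pow_add]), AddValuation.map_mul, map_add,
      WithTop.coe_add]
    exact add_le_add hd he
  | single i e =>
    rw [Finsupp.weight_single, Finsupp.prod_single_index (by simp), AddValuation.map_pow,
      WithTop.coe_nsmul]
    exact nsmul_le_nsmul_right (hg i) e

/-- If `C * γ` is at least `-m * p ^ j` on `A_j` and at least `-m * p ^ j + E` on `Z_j`, then every
polynomial in `isobaric p k w` takes a value of positive valuation as soon as `m * w < E * k`. -/
lemma map_aeval_pos {p k w : ℕ} {f : MvPolynomial (ℕ ⊕ ℕ) ℤ} (hf : f ∈ isobaric p k w)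
    {g : ℕ ⊕ ℕ → L} {γ : ℕ ⊕ ℕ → ℤ} (hg : ∀ i, (γ i : WithTop ℤ) ≤ v (g i)) {C m E : ℕ}
    (hγl : ∀ j, -(m * p ^ j : ℤ) ≤ C * γ (.inl j))
    (hγr : ∀ j, -(m * p ^ j : ℤ) + E ≤ C * γ (.inr j)) (h : m * w < E * k) :
    0 < v (aeval g f) := by
  have hweight (d : ℕ ⊕ ℕ →₀ ℕ) :
      -(m * Finsupp.weight (Sum.elim (p ^ ·) (p ^ ·) : ℕ ⊕ ℕ → ℕ) d : ℤ) +
        E * Finsupp.weight (Sum.elim 0 1 : ℕ ⊕ ℕ → ℕ) d ≤ C * Finsupp.weight γ d := by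
    induction d using Finsupp.induction_linear with
    | zero => simp
    | add d e hd he =>
      simp only [map_add, Nat.cast_add]
      linarith
    | single i e =>
      rcases i with j | j
      · have := mul_le_mul_of_nonneg_left (hγl j) (Nat.cast_nonneg (α := ℤ) e)
        simp [Finsupp.weight_single]
        linarith
      · have := mul_le_mul_of_nonneg_left (hγr j) (Nat.cast_nonneg (α := ℤ) e)
        simp [Finsupp.weight_single]
        linarith
  rw [f.as_sum, map_sum]
  refine v.map_lt_sum WithTop.zero_ne_top fun d hd => ?_
  obtain ⟨hw, hk⟩ := (mem_restrictSupport_iff _).mp hf hd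
  have hd' := hweight d
  rw [hw] at hd'
  have hpos : 0 < Finsupp.weight γ d := by
    zify at h hk
    have := mul_le_mul_of_nonneg_left hk (Nat.cast_nonneg (α := ℤ) E)
    exact pos_of_mul_pos_right (a := (C : ℤ)) (by linarith) (Nat.cast_nonneg C)
  rw [aeval_monomial, AddValuation.map_mul, algebraMap_int_eq, eq_intCast]
  calc (0 : WithTop ℤ) < ((Finsupp.weight γ d : ℤ) : WithTop ℤ) := by exact_mod_cast hpos
    _ ≤ v (d.prod fun i e => g i ^ e) := le_map_finsuppProd v hg d
    _ ≤ _ := le_add_of_nonneg_left (le_map_intCast v _)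

end Valuation

/-- Integral lower bounds for the valuations of `x` and `b`, valid also when these are zero. -/
lemma exists_bounds {L : Type*} [Field L] (v : AddValuation L (WithTop ℤ)) {q m : ℕ} {x b : L}
    (hx : ((-m : ℤ) : WithTop ℤ) ≤ q • v x) (hb : ((m - 1 : ℤ) : WithTop ℤ) ≤ v b)
    (hb' : q • v x = ((-m : ℤ) : WithTop ℤ) → ((m : ℤ) : WithTop ℤ) ≤ v b) (hm : 1 ≤ m) :
    ∃ α β : ℤ, (α : WithTop ℤ) ≤ v x ∧ (β : WithTop ℤ) ≤ v b ∧ -(m : ℤ) ≤ q * α ∧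
      (m - 1 : ℤ) ≤ β ∧ (-(m : ℤ) + 1 ≤ q * α ∨ (m : ℤ) ≤ β) := by
  obtain hx0 | ⟨α, hα⟩ : v x = ⊤ ∨ ∃ α : ℤ, (α : WithTop ℤ) = v x := by
    rw [← WithTop.ne_top_iff_exists]
    exact em _
  · refine ⟨0, m - 1, by simp [hx0], hb, by simp, le_rfl, .inl ?_⟩
    omega
  · rw [← hα, ← WithTop.coe_nsmul, WithTop.coe_le_coe, nsmul_eq_mul] at hx
    rw [← hα, ← WithTop.coe_nsmul, WithTop.coe_inj, nsmul_eq_mul] at hb'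
    by_cases h : (q : ℤ) * α = -m
    · exact ⟨α, m, hα.le, hb' h, hx, by omega, .inr le_rfl⟩
    · exact ⟨α, m - 1, hα.le, hb, hx, le_rfl, .inl (by omega)⟩

/-- The valuation estimate for the difference of the Witt vectors `(x_j (1 + b_j))_j` and
`(x_j)_j`, in terms of lower bounds `α j`, `β j` for the valuations of `x j` and `b j`. -/
theorem map_coeff_sub_pos {L : Type*} [CommRing L] (v : AddValuation L (WithTop ℤ)) {m n : ℕ}
    (hm : 2 ≤ m) (x b : ℕ → L) (α β : ℕ → ℤ) (hα : ∀ j, (α j : WithTop ℤ) ≤ v (x j))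
    (hβ : ∀ j, (β j : WithTop ℤ) ≤ v (b j)) (hα' : ∀ j, -(m * p ^ j : ℤ) ≤ p ^ n * α j)
    (hβ' : ∀ j, (m - 1 : ℤ) ≤ β j)
    (hαβ : ∀ j, -(m * p ^ j : ℤ) + 1 ≤ p ^ n * α j ∨ (m : ℤ) ≤ β j) :
    0 < v ((WittVector.mk p (fun j => x j + x j * b j) - WittVector.mk p x).coeff n -
      ∑ j ∈ Finset.range (n + 1), x j ^ p ^ (n - j) * b j) := by
  have hp : p.Prime := Fact.out
  have hpn : (1 : ℤ) ≤ (p : ℤ) ^ n := by exact_mod_cast Nat.one_le_pow _ _ hp.pos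
  obtain ⟨k, rfl⟩ : ∃ k, m = k + 1 := ⟨m - 1, by omega⟩
  have key := map_aeval_pos v (diffPoly_sub_diffLinear_mem_isobaric (p := p) n)
    (g := Sum.elim x fun j => x j * b j) (γ := Sum.elim α fun j => α j + β j) (C := p ^ n)
    (m := k + 1) (E := p ^ n * k + 1) ?_ ?_ ?_ ?_
  · rw [map_sub, aeval_diffPoly] at key
    convert key using 3
    rw [diffLinear, map_sum]
    refine Finset.sum_congr rfl fun j _ => ?_
    rw [map_mul, map_pow, aeval_X, aeval_X, Sum.elim_inl, Sum.elim_inr, ← mul_assoc, ← pow_succ,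
      Nat.sub_add_cancel (Nat.one_le_pow _ _ hp.pos)]
  · rintro (j | j)
    · exact hα j
    · simpa [AddValuation.map_mul] using add_le_add (hα j) (hβ j)
  · intro j
    simpa using hα' j
  · intro j
    have h₁ := hα' j
    have h₂ := hβ' j
    simp only [Sum.elim_inr]
    push_cast at h₁ h₂ ⊢
    rcases hαβ j with h | h <;> push_cast at h <;> nlinarith
  · have := Nat.one_le_pow n p hp.pos
    nlinarith [Nat.mul_le_mul_left (p ^ n) (show 1 ≤ k by omega)]

end WittDifference

noncomputable section

open TruncatedWittVector

variable (p : ℕ) [Fact p.Prime] (L : Type*) [Field L] [CharP L p]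
variable (v : AddValuation L (WithTop ℤ))

/-- Lemma 2.9 of the paper.  Let `m ≥ 2`, `s ≥ 0`,
`s' = min(ord_p m, s)`.  Let `a = (a_{s-1}, …, a_0) ∈ W_s(L)` with
`p^i · ord_L(a_i) ≥ -m` for all `i` and `p^i · ord_L(a_i) ≥ -(m-1)` for `i ≥ s'`
(i.e. `a ∈ fil'_m W_s(L)`, componentwise).  Let `b_{s-1}, …, b_0 ∈ L` with
`ord_L(b_i) ≥ m - 1` for all `i` and `ord_L(b_i) ≥ m` whenever `p^i · ord_L(a_i) = -m`.
Let `ã` have components `ã_i = a_i (1 + b_i)` and `c = (c_{s-1}, …, c_0) = ã - a`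
(difference in the Witt ring).  Then
`ord_L(c_0 - ∑_{i=0}^{s-1} a_i^{p^i} b_i) > 0`.
(The paper's component of index `i` is the standard component of index `s - 1 - i`;
in particular `c_0` is the standard component of index `s - 1`, extracted below by a
`dite` which is vacuous only in the degenerate case `s = 0`.) -/
theorem statement19 (hv : ∃ π : L, v π = 1) (m s : ℕ) (hm : 2 ≤ m)
    (a : TruncatedWittVector p s L) (b : Fin s → L)
    (ha : ∀ j : Fin s,
        ((-(m : ℤ)) : WithTop ℤ) ≤ p ^ (s - 1 - (j : ℕ)) • v (a.coeff j))
    (ha' : ∀ j : Fin s, (j : ℕ) < s - min (padicValNat p m) s →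
        ((-((m : ℤ) - 1)) : WithTop ℤ) ≤ p ^ (s - 1 - (j : ℕ)) • v (a.coeff j))
    (hb : ∀ j : Fin s, (((m : ℤ) - 1) : WithTop ℤ) ≤ v (b j))
    (hb' : ∀ j : Fin s,
        p ^ (s - 1 - (j : ℕ)) • v (a.coeff j) = ((-(m : ℤ)) : WithTop ℤ) →
        ((m : ℤ) : WithTop ℤ) ≤ v (b j)) :
    (0 : WithTop ℤ) <
      v ((if hs : 0 < s then
            (TruncatedWittVector.mk p (fun i => a.coeff i * (1 + b i)) - a).coeff
              ⟨s - 1, by omega⟩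
          else 0) -
        ∑ j : Fin s, a.coeff j ^ (p ^ (s - 1 - (j : ℕ))) * b j) := by
  rcases s with _ | n
  · simp
  let x : ℕ → L := fun j => if h : j < n + 1 then a.coeff ⟨j, h⟩ else 0
  let b₀ : ℕ → L := fun j => if h : j < n + 1 then b ⟨j, h⟩ else 0
  have hp : p.Prime := Fact.out
  have hxi (j : ℕ) (hj : j < n + 1) : x j = a.coeff ⟨j, hj⟩ := dif_pos hj
  have hbi (j : ℕ) (hj : j < n + 1) : b₀ j = b ⟨j, hj⟩ := dif_pos hj
  have hbounds (j : ℕ) : ∃ α β : ℤ, (α : WithTop ℤ) ≤ v (x j) ∧ (β : WithTop ℤ) ≤ v (b₀ j) ∧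
      -(m * p ^ j : ℤ) ≤ p ^ n * α ∧ (m - 1 : ℤ) ≤ β ∧
      (-(m * p ^ j : ℤ) + 1 ≤ p ^ n * α ∨ (m : ℤ) ≤ β) := by
    by_cases hj : j < n + 1
    · obtain ⟨α, β, h₁, h₂, h₃, h₄, h₅⟩ :=
        WittDifference.exists_bounds v (ha ⟨j, hj⟩) (hb ⟨j, hj⟩) (hb' ⟨j, hj⟩) (by omega)
      have hpow : (p : ℤ) ^ n = p ^ (n - j) * p ^ j := by
        rw [← pow_add, Nat.sub_add_cancel (by omega)]
      have hpj : (1 : ℤ) ≤ (p : ℤ) ^ j := by exact_mod_cast Nat.one_le_pow _ _ hp.pos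
      simp only [Nat.add_sub_cancel, Nat.cast_pow] at h₃ h₅
      refine ⟨α, β, by rwa [hxi j hj], by rwa [hbi j hj], ?_, h₄,
        h₅.imp_left fun h => ?_⟩ <;> rw [hpow] <;> nlinarith
    · exact ⟨0, m, by simp [show x j = 0 from dif_neg hj],
        by simp [show b₀ j = 0 from dif_neg hj], by simp; positivity, by omega, .inr le_rfl⟩
  choose α β h₁ h₂ h₃ h₄ h₅ using hbounds
  have key := WittDifference.map_coeff_sub_pos (p := p) v hm x b₀ α β h₁ h₂ h₃ h₄ h₅
  have hx : WittVector.truncate (n + 1) (WittVector.mk p x) = a := by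
    ext i
    simp only [WittVector.coeff_truncate, WittVector.coeff_mk, hxi i i.2]
  have hx' : WittVector.truncate (n + 1) (WittVector.mk p fun j => x j + x j * b₀ j) =
      TruncatedWittVector.mk p fun i => a.coeff i * (1 + b i) := by
    ext i
    simp only [WittVector.coeff_truncate, WittVector.coeff_mk, hxi i i.2, hbi i i.2, coeff_mk]
    ring
  rw [dif_pos n.succ_pos, ← hx', ← hx, ← map_sub, WittVector.coeff_truncate]
  rw [Finset.sum_range] at key
  simpa only [WittVector.coeff_truncate, WittVector.coeff_mk, hbi _ (Fin.is_lt _), Fin.eta,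
    Nat.add_sub_cancel] using key
end
end
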